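/- arXiv:1707.05304 — 4 statements merged into one kernel-verified Lean document; each statement's English description precedes it below -/
import Mathlib

section
/- Let Ṡ be a tick stream at tick (tm, cm) with underlying stream S, and let n ∈ ℕ. Then the underlying stream of the time window τ_n(Ṡ) over the tick stream equals the sliding time-based window τ_n(S) = τ_n(S, tm) of the underlying stream; in other words, τ_n(S) underlies τ_n(Ṡ). -/
namespace Ticker

/-- A tick: a pair of a time and a count. -/
abbrev Tick := ℕ × ℕ

/-- `k'` is the time increment or the count increment of `k`. -/
def TickStep (k k' : Tick) : Prop := k' = (k.1 + 1, k.2) ∨ k' = (k.1, k.2 + 1)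

/-- A tick pattern: a nonempty finite sequence of ticks where each successive tick is
either the time increment or the count increment of the previous one. -/
def IsTickPattern (K : List Tick) : Prop := K ≠ [] ∧ K.Chain' TickStep

/-- A stream: a timeline `[t1, tm]` (a closed nonempty interval of ℕ) together with
an evaluation assigning a finite set of atoms to every time point, empty outside
the timeline. -/
structure TStream (A : Type) [DecidableEq A] where
  t1 : ℕ
  tm : ℕ
  le : t1 ≤ tm
  v : ℕ → Finset A
  outside : ∀ t, (t < t1 ∨ tm < t) → v t = ∅

variable {A : Type} [DecidableEq A]

/-- The tuple size `|S|` of a stream: the total number of (atom, time point) pairs. -/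
def TStream.size (S : TStream A) : ℕ := ∑ t ∈ Finset.Icc S.t1 S.tm, (S.v t).card

/-- The sliding time-based window `τ_n(S, t)` for size `n` at `t ∈ T`. -/
def TStream.timeWin (S : TStream A) (n t : ℕ) (ht : S.t1 ≤ t) : TStream A where
  t1 := max S.t1 (t - n)
  tm := t
  le := max_le ht (Nat.sub_le t n)
  v := fun u => if max S.t1 (t - n) ≤ u ∧ u ≤ t then S.v u else ∅
  outside := by
    intro u hu
    apply if_neg
    rintro ⟨h1, h2⟩
    rcases hu with h | h
    · exact absurd h1 (not_le.mpr h)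
    · exact absurd h2 (not_le.mpr h)

/-- The left endpoint `t' = max ({ u ∈ T | |τ_{t-u}(S,t)| ≥ n } ∪ {t1})` used in the
definition of sliding tuple-based windows. -/
def TStream.leftEP (S : TStream A) (n t : ℕ) (ht : S.t1 ≤ t) : ℕ :=
  (insert S.t1 ((Finset.Icc S.t1 t).filter fun u => n ≤ (S.timeWin (t - u) t ht).size)).max'
    (Finset.insert_nonempty _ _)

/-- `S'` is a sliding tuple-based window of `S` of size `n` at `t`. -/
def IsTupleWin (S : TStream A) (n t : ℕ) (ht : S.t1 ≤ t) (S' : TStream A) : Prop :=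
  if (S.timeWin (t - S.leftEP n t ht) t ht).size ≤ n then
    S' = S.timeWin (t - S.leftEP n t ht) t ht
  else
    S'.t1 = S.leftEP n t ht ∧ S'.tm = t ∧
    (∀ u, S.leftEP n t ht + 1 ≤ u → u ≤ t → S'.v u = S.v u) ∧
    S'.v (S.leftEP n t ht) ⊆ S.v (S.leftEP n t ht) ∧
    (∀ u, u < S.leftEP n t ht ∨ t < u → S'.v u = ∅) ∧
    S'.size = n

/-- A sequence of ticks together with an evaluation (no well-formedness conditions). -/
structure PreTick (A : Type) [DecidableEq A] where
  K : List Tick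
  vdot : Tick → Finset A

/-- The time of the first tick. -/
def PreTick.t1 (P : PreTick A) : ℕ := (P.K.head?.getD (0, 0)).1

/-- The time of the last tick. -/
def PreTick.tm (P : PreTick A) : ℕ := (P.K.getLast?.getD (0, 0)).1

/-- The count of the first tick. -/
def PreTick.c1 (P : PreTick A) : ℕ := (P.K.head?.getD (0, 0)).2

/-- The count of the last tick. -/
def PreTick.cm (P : PreTick A) : ℕ := (P.K.getLast?.getD (0, 0)).2

/-- All atoms evaluated at time `t`: the union `⋃ { v̇(t,c) : (t,c) ∈ K }`. -/
def PreTick.atTime (P : PreTick A) (t : ℕ) : Finset A :=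
  ((P.K.filter fun k => decide (k.1 = t)).map P.vdot).foldr (· ∪ ·) ∅

/-- A tick stream: a tick pattern with an evaluation assigning the empty set to the
first tick, a singleton to every count increment, and the empty set to every time
increment. -/
structure TickStream (A : Type) [DecidableEq A] extends PreTick A where
  ne : K ≠ []
  chain : K.Chain' TickStep
  init : ∀ k ∈ K.head?, vdot k = ∅
  incr : K.Chain' fun k k' => if k' = (k.1, k.2 + 1) then ∃ a, vdot k' = {a} else vdot k' = ∅

/-- The time window `τ_n` over tick streams: keep the ticks `(t', c')` with
`max(t1, tm − n) ≤ t' ≤ tm`, with the restricted evaluation. -/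
def PreTick.timeWin (P : PreTick A) (n : ℕ) : PreTick A :=
  ⟨P.K.filter fun k => decide (max P.t1 (P.tm - n) ≤ k.1 ∧ k.1 ≤ P.tm), P.vdot⟩

/-- The tuple window `#_n` over tick streams: keep the ticks `(t', c')` with
`max(c1, cm − n + 1) ≤ c' ≤ cm`, with the restricted evaluation. -/
def PreTick.tupleWin (P : PreTick A) (n : ℕ) : PreTick A :=
  ⟨P.K.filter fun k => decide (max P.c1 (P.cm + 1 - n) ≤ k.2 ∧ k.2 ≤ P.cm), P.vdot⟩

/-- The stream `S` underlies the tick data `(K, v̇)`: same endpoints of the timeline,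
and the evaluation at every `t` is the union of the tick evaluations at time `t`. -/
def Underlies (S : TStream A) (P : PreTick A) : Prop :=
  (∃ k ∈ P.K.head?, S.t1 = k.1) ∧ (∃ k ∈ P.K.getLast?, S.tm = k.1) ∧
    ∀ t, S.v t = P.atTime t

/-- Pairwise distinct atoms per time point: distinct ticks with the same time
component carry distinct atoms. -/
def DistinctPerTime (P : PreTick A) : Prop :=
  ∀ k ∈ P.K, ∀ k' ∈ P.K, k ≠ k' → k.1 = k'.1 →
    ∀ a a', P.vdot k = {a} → P.vdot k' = {a'} → a ≠ a'


theorem TickStep.fst_le {k k' : Tick} (h : TickStep k k') : k.1 ≤ k'.1 := by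
  rcases h with rfl | rfl <;> simp

theorem TickStep.fst_le_succ {k k' : Tick} (h : TickStep k k') : k'.1 ≤ k.1 + 1 := by
  rcases h with rfl | rfl <;> simp

/-- Times never decrease along a tick pattern, so the last tick has the largest time. -/
theorem fst_le_getLast_fst {l : List Tick} (hl : l.IsChain TickStep) {z : Tick}
    (hz : l.getLast? = some z) {k : Tick} (hk : k ∈ l) : k.1 ≤ z.1 := by
  induction l generalizing k with
  | nil => simp at hk
  | cons a t ih =>
    cases t with
    | nil => simp_all
    | cons b t =>
      rw [List.isChain_cons_cons] at hl
      rw [List.getLast?_cons_cons] at hz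
      rcases List.mem_cons.mp hk with rfl | hk
      · exact hl.1.fst_le.trans (ih hl.2 hz List.mem_cons_self)
      · exact ih hl.2 hz hk

/-- Times increase by at most one per step, so the first tick with time at least `L` has
time exactly `L` whenever `L` lies between the first and the last time. -/
theorem exists_head?_filter_le_fst {l : List Tick} (hl : l.IsChain TickStep) {a z : Tick} {L : ℕ}
    (ha : l.head? = some a) (hz : l.getLast? = some z) (haL : a.1 ≤ L) (hLz : L ≤ z.1) :
    ∃ k ∈ (l.filter fun k => decide (L ≤ k.1)).head?, L = k.1 := by
  induction l generalizing a with
  | nil => simp at ha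
  | cons b t ih =>
    obtain rfl : b = a := by simpa using ha
    rcases haL.eq_or_lt with h | h
    · exact ⟨b, by simp [h], h.symm⟩
    · cases t with
      | nil =>
        obtain rfl : b = z := by simpa using hz
        omega
      | cons c t =>
        rw [List.isChain_cons_cons] at hl
        rw [List.getLast?_cons_cons] at hz
        rw [List.filter_cons_of_neg (by simpa using h)]
        exact ih hl.2 rfl hz (hl.1.fst_le_succ.trans h)

theorem getLast?_filter_of_pos {α : Type*} {l : List α} {p : α → Bool} {z : α}
    (hz : l.getLast? = some z) (hp : p z = true) : (l.filter p).getLast? = some z := by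
  obtain ⟨t, rfl⟩ := List.getLast?_eq_some_iff.mp hz
  simp [List.filter_append, hp]

/-- Restricting to times in `[L, U]` keeps exactly the atoms at those times. -/
theorem atTime_filter (K : List Tick) (f : Tick → Finset A) (L U t : ℕ) :
    (PreTick.mk (K.filter fun k => decide (L ≤ k.1 ∧ k.1 ≤ U)) f).atTime t =
      if L ≤ t ∧ t ≤ U then (PreTick.mk K f).atTime t else ∅ := by
  unfold PreTick.atTime
  simp only [List.filter_filter]
  split_ifs with h
  · congr 2
    refine List.filter_congr fun k _ => ?_
    by_cases hk : k.1 = t <;> simp [hk, h]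
  · rw [List.filter_eq_nil_iff.mpr]
    · rfl
    · rintro k - hk
      simp only [Bool.and_eq_true, decide_eq_true_eq] at hk
      exact h (hk.1 ▸ hk.2)

/-- If the stream `S` underlies the tick stream `Ṡ`, then the sliding
time-based window `τ_n(S) = τ_n(S, tm)` of `S` underlies the time window `τ_n(Ṡ)`
over the tick stream. -/
theorem underlying_of_timeWindow {A : Type} [Countable A] [DecidableEq A]
    (Sd : TickStream A) (S : TStream A) (n : ℕ)
    (hU : Underlies S Sd.toPreTick) :
    Underlies (S.timeWin n S.tm S.le) (Sd.toPreTick.timeWin n) := by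
  obtain ⟨⟨a, ha, hS1⟩, ⟨z, hz, hSm⟩, hv⟩ := hU
  rw [Option.mem_def] at ha hz
  have ht1 : Sd.toPreTick.t1 = S.t1 := by simp [PreTick.t1, ha, hS1]
  have htm : Sd.toPreTick.tm = S.tm := by simp [PreTick.tm, hz, hSm]
  have hLm : max S.t1 (S.tm - n) ≤ S.tm := max_le S.le (Nat.sub_le _ _)
  unfold PreTick.timeWin
  rw [ht1, htm]
  refine ⟨?_, ⟨z, getLast?_filter_of_pos hz (decide_eq_true (hSm ▸ ⟨hLm, le_rfl⟩)), hSm⟩, fun t => ?_⟩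
  · have hK : (Sd.K.filter fun k => decide (max S.t1 (S.tm - n) ≤ k.1 ∧ k.1 ≤ S.tm)) =
        Sd.K.filter fun k => decide (max S.t1 (S.tm - n) ≤ k.1) :=
      List.filter_congr fun k hk => by
        have := fst_le_getLast_fst Sd.chain hz hk
        simp [hSm, this]
    simp only [hK]
    exact exists_head?_filter_le_fst Sd.chain ha hz (hS1 ▸ le_max_left _ _) (hSm ▸ hLm)
  · rw [atTime_filter]
    simp only [TStream.timeWin, hv]

end Ticker
end

section
/- Let Ṡ = (K, v̇) be a tick stream at tick (tm, cm) that has pairwise distinct atoms per time point, let S be its underlying stream, and let n ≥ 1. Then the underlying stream of the tuple window #_n(Ṡ) over the tick stream is a sliding tuple-based window of S of size n at tm; that is, writing t' = max({ u ∈ [t1, tm] : |τ_{tm−u}(S, tm)| ≥ n } ∪ {t1}) for the left endpoint prescribed by the definition, the underlying stream S'' of #_n(Ṡ) equals τ_{tm−t'}(S, tm) if |τ_{tm−t'}(S, tm)| ≤ n, and otherwise S'' has timeline [t', tm], agrees with S on [t'+1, tm], has its evaluation at t' contained in that of S, and has tuple size |S''| = n. -/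
namespace Ticker

variable {A : Type} [DecidableEq A]

/-- The count increments of the tick sequence `K`, running from the tick `k₁` to the tick `m`, are
the ticks `(T c, c)` for `k₁.2 < c ≤ m.2`, and `v` evaluates them to the singletons `s c` and every
other tick of `K` to `∅`. -/
structure Enumerates (v : Tick → Finset A) (K : List Tick) (k₁ m : Tick) (T : ℕ → ℕ)
    (s : ℕ → Finset A) : Prop where
  bounds : ∀ k ∈ K, k₁ ≤ k ∧ k ≤ m
  mem : ∀ c, k₁.2 < c → c ≤ m.2 → (T c, c) ∈ K
  le_time : ∀ k ∈ K, ∀ c, k₁.2 < c → c ≤ k.2 → T c ≤ k.1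
  eval : ∀ k ∈ K, ∀ x, x ∈ v k ↔ k₁.2 < k.2 ∧ k.1 = T k.2 ∧ x ∈ s k.2
  singleton : ∀ c, k₁.2 < c → c ≤ m.2 → ∃ a, s c = {a}

theorem exists_enumerates {A : Type} (v : Tick → Finset A) (k₁ : Tick) (hinit : v k₁ = ∅)
    (L : List Tick) (hchain : (k₁ :: L).IsChain TickStep)
    (hincr : (k₁ :: L).IsChain
      fun k k' => if k' = (k.1, k.2 + 1) then ∃ a, v k' = {a} else v k' = ∅) :
    ∀ m ∈ (k₁ :: L).getLast?, ∃ T s, Enumerates v (k₁ :: L) k₁ m T s := by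
  induction L using List.reverseRecOn with
  | nil =>
    rintro m hm
    obtain rfl : k₁ = m := by simpa using hm
    refine ⟨fun _ => 0, fun _ => ∅, ⟨?_, ?_, ?_, ?_, ?_⟩⟩
    · simp
    · intro c; omega
    · simp only [List.mem_singleton]; rintro k rfl c; omega
    · simp [hinit]
    · intro c; omega
  | append_singleton L k' ih =>
    rw [← List.cons_append, List.isChain_append] at hchain hincr
    intro m' hm'
    obtain rfl : k' = m' := by
      rw [← List.cons_append, List.getLast?_append] at hm'
      simpa using hm'
    obtain ⟨m, hm⟩ : ∃ m, m ∈ (k₁ :: L).getLast? := by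
      simp [List.getLast?_cons]
    obtain ⟨T, s, hT⟩ := ih hchain.1 hincr.1 m hm
    have hs : TickStep m k' := hchain.2.2 m hm k' (by simp)
    have hi := hincr.2.2 m hm k' (by simp)
    have hmK : m ∈ k₁ :: L := List.mem_of_getLast? hm
    have hk₁m : k₁ ≤ m := (hT.bounds m hmK).1
    have hmem : ∀ k, k ∈ k₁ :: (L ++ [k']) ↔ k ∈ k₁ :: L ∨ k = k' := by simp [or_assoc]
    have hmk' : m ≤ k' := by
      rcases hs with rfl | rfl <;> simp [Prod.le_def]
    have hbounds : ∀ k ∈ k₁ :: (L ++ [k']), k₁ ≤ k ∧ k ≤ k' := by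
      intro k hk
      rcases (hmem k).1 hk with hk | rfl
      · exact ⟨(hT.bounds k hk).1, (hT.bounds k hk).2.trans hmk'⟩
      · exact ⟨hk₁m.trans hmk', le_rfl⟩
    rcases hs with rfl | rfl
    · simp only [Prod.mk.injEq, Nat.add_eq_left, one_ne_zero, false_and, if_false] at hi
      refine ⟨T, s, hbounds, ?_, ?_, ?_, hT.singleton⟩
      · intro c h1 h2
        exact (hmem _).2 (.inl (hT.mem c h1 h2))
      · intro k hk c h1 h2
        rcases (hmem k).1 hk with hk | rfl
        · exact hT.le_time k hk c h1 h2
        · exact (hT.le_time m hmK c h1 h2).trans (Nat.le_succ _)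
      · intro k hk x
        rcases (hmem k).1 hk with hk | rfl
        · exact hT.eval k hk x
        · simp only [hi, Finset.notMem_empty, false_iff]
          rintro ⟨h1, h2, -⟩
          have := hT.le_time m hmK m.2 h1 le_rfl
          omega
    · simp only [if_true] at hi
      obtain ⟨b, hb⟩ := hi
      have hk₁m2 : k₁.2 ≤ m.2 := hk₁m.2
      have hle : ∀ k ∈ k₁ :: L, k.2 ≤ m.2 := fun k hk => (hT.bounds k hk).2.2
      refine ⟨Function.update T (m.2 + 1) m.1, Function.update s (m.2 + 1) {b}, hbounds,
        ?_, ?_, ?_, ?_⟩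
      · intro c h1 h2
        rw [hmem]
        by_cases hc : c = m.2 + 1
        · subst hc; simp
        · rw [Function.update_of_ne hc]
          exact .inl (hT.mem c h1 (by simp only at h2; omega))
      · intro k hk c h1 h2
        rcases (hmem k).1 hk with hk | rfl
        · have := hle k hk
          rw [Function.update_of_ne (by omega)]
          exact hT.le_time k hk c h1 h2
        · by_cases hc : c = m.2 + 1
          · subst hc; simp
          · rw [Function.update_of_ne hc]
            exact hT.le_time m hmK c h1 (by simp only at h2; omega)
      · intro k hk x
        rcases (hmem k).1 hk with hk | rfl
        · have := hle k hk
          rw [Function.update_of_ne (by omega), Function.update_of_ne (by omega)]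
          exact hT.eval k hk x
        · simp [hb]; omega
      · intro c h1 h2
        by_cases hc : c = m.2 + 1
        · subst hc; simp
        · rw [Function.update_of_ne hc]
          exact hT.singleton c h1 (by simp only at h2; omega)

theorem PreTick.mem_atTime (P : PreTick A) (t : ℕ) (x : A) :
    x ∈ P.atTime t ↔ ∃ k ∈ P.K, k.1 = t ∧ x ∈ P.vdot k := by
  have (l : List (Finset A)) : x ∈ l.foldr (· ∪ ·) ∅ ↔ ∃ s ∈ l, x ∈ s := by
    induction l with
    | nil => simp
    | cons s l ih => simp [ih]
  simp [PreTick.atTime, this, and_assoc]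

theorem TStream.ext {S S' : TStream A} (h1 : S.t1 = S'.t1) (hm : S.tm = S'.tm)
    (hv : ∀ t, S.v t = S'.v t) : S = S' := by
  cases S; cases S'
  obtain rfl := h1
  obtain rfl := hm
  obtain rfl := funext hv
  rfl

theorem TStream.timeWin_sub_t1 (S : TStream A) {t u : ℕ} (ht : S.t1 ≤ t) (h1 : S.t1 ≤ u)
    (h2 : u ≤ t) : (S.timeWin (t - u) t ht).t1 = u := by
  simp only [TStream.timeWin]; omega

theorem TStream.timeWin_sub_v (S : TStream A) {t u : ℕ} (ht : S.t1 ≤ t) (h1 : S.t1 ≤ u)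
    (h2 : u ≤ t) (w : ℕ) :
    (S.timeWin (t - u) t ht).v w = if u ≤ w ∧ w ≤ t then S.v w else ∅ := by
  have : max S.t1 (t - (t - u)) = u := by omega
  simp only [TStream.timeWin, this]

theorem TStream.timeWin_sub_size (S : TStream A) {t u : ℕ} (ht : S.t1 ≤ t) (h1 : S.t1 ≤ u)
    (h2 : u ≤ t) :
    (S.timeWin (t - u) t ht).size = ∑ w ∈ Finset.Icc u t, (S.v w).card := by
  rw [TStream.size, S.timeWin_sub_t1 ht h1 h2]
  refine Finset.sum_congr rfl fun w hw => ?_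
  rw [S.timeWin_sub_v ht h1 h2, if_pos (Finset.mem_Icc.1 hw)]

theorem TStream.leftEP_eq (S : TStream A) {n t u : ℕ} (ht : S.t1 ≤ t) (h1 : S.t1 ≤ u)
    (h2 : u ≤ t) (hu : u = S.t1 ∨ n ≤ ∑ w ∈ Finset.Icc u t, (S.v w).card)
    (hlt : ∀ w, u < w → w ≤ t → ∑ w ∈ Finset.Icc w t, (S.v w).card < n) :
    S.leftEP n t ht = u := by
  rw [TStream.leftEP, Finset.max'_eq_iff]
  constructor
  · simp only [Finset.mem_insert, Finset.mem_filter, Finset.mem_Icc]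
    refine hu.imp id fun hu => ⟨⟨h1, h2⟩, ?_⟩
    rwa [S.timeWin_sub_size ht h1 h2]
  · simp only [Finset.mem_insert, Finset.mem_filter, Finset.mem_Icc]
    rintro w (rfl | ⟨⟨hw1, hw2⟩, hw⟩)
    · exact h1
    · rw [S.timeWin_sub_size ht hw1 hw2] at hw
      by_contra h
      exact absurd (hlt w (by omega) hw2) (by omega)

/-- A stream that places the singleton `s c` at time `T c` for each `c ∈ D` has as many tuples as
`D` has elements, provided that the singletons placed at the same time are disjoint. -/
theorem sum_card_biUnion_fiber (D : Finset ℕ) (T : ℕ → ℕ) (s : ℕ → Finset A) (v : ℕ → Finset A)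
    (hv : ∀ t, v t = {c ∈ D | T c = t}.biUnion s) (hs : ∀ c ∈ D, (s c).card = 1)
    (hdisj : ∀ c ∈ D, ∀ d ∈ D, T c = T d → c ≠ d → Disjoint (s c) (s d))
    (u t : ℕ) (ht : ∀ c ∈ D, T c ≤ t) :
    ∑ w ∈ Finset.Icc u t, (v w).card = {c ∈ D | u ≤ T c}.card := by
  rw [Finset.card_eq_sum_card_fiberwise (f := T) (t := Finset.Icc u t)]
  · refine Finset.sum_congr rfl fun w hw => ?_
    rw [hv, Finset.card_biUnion, Finset.sum_congr rfl (g := fun _ => 1), Finset.sum_const,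
      smul_eq_mul, mul_one]
    · congr 1
      ext c
      simp only [Finset.mem_filter, Finset.mem_Icc] at hw ⊢
      constructor
      · rintro ⟨h, rfl⟩; exact ⟨⟨h, hw.1⟩, rfl⟩
      · rintro ⟨⟨h, -⟩, rfl⟩; exact ⟨h, rfl⟩
    · intro c hc
      exact hs c (Finset.mem_filter.1 hc).1
    · intro c hc d hd h
      rw [Finset.mem_coe, Finset.mem_filter] at hc hd
      exact hdisj c hc.1 d hd.1 (hc.2.trans hd.2.symm) h
  · intro c hc
    simp only [Finset.coe_filter, Set.mem_ofPred_eq] at hc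
    simpa using ⟨hc.2, ht c hc.1⟩

/-- Let `Ṡ` be a tick stream with pairwise distinct atoms per time
point, let `S` be its underlying stream and let `n ≥ 1`. Then the underlying stream
of the tuple window `#_n(Ṡ)` over the tick stream is a sliding tuple-based window
of `S` of size `n` at `tm`. -/
theorem underlying_of_tupleWindow {A : Type} [Countable A] [DecidableEq A]
    (Sd : TickStream A) (S : TStream A) (n : ℕ) (hn : 1 ≤ n)
    (hdist : DistinctPerTime Sd.toPreTick)
    (hU : Underlies S Sd.toPreTick)
    (S'' : TStream A) (hU'' : Underlies S'' (Sd.toPreTick.tupleWin n)) :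
    IsTupleWin S n S.tm S.le S'' := by
  obtain ⟨⟨K, v⟩, _, hchain, hinit, hincr⟩ := Sd
  obtain ⟨⟨k₁, hk₁, ht1⟩, ⟨m, hm, htm⟩, hv⟩ := hU
  obtain ⟨⟨k₀, hk₀, ht1'⟩, ⟨m', hm', htm'⟩, hv''⟩ := hU''
  rw [Option.mem_def] at hk₁ hm
  have hc1 : PreTick.c1 ⟨K, v⟩ = k₁.2 := by simp only [PreTick.c1, hk₁, Option.getD_some]
  have hcm : PreTick.cm ⟨K, v⟩ = m.2 := by simp only [PreTick.cm, hm, Option.getD_some]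
  simp only [PreTick.mem_atTime, Finset.ext_iff] at hv hv''
  simp only [PreTick.tupleWin, hc1, hcm] at hk₀ hm' hv''
  obtain ⟨T, s, hT⟩ : ∃ T s, Enumerates v K k₁ m T s := by
    obtain ⟨L, rfl⟩ := List.head?_eq_some_iff.1 hk₁
    exact exists_enumerates v k₁ (hinit k₁ hk₁) L hchain hincr m hm
  have hmK : m ∈ K := List.mem_of_getLast? hm
  set c₀ := m.2 + 1 - n with hc₀
  have hfilter : ∀ k ∈ K, (max k₁.2 c₀ ≤ k.2 ∧ k.2 ≤ m.2) ↔ c₀ ≤ k.2 := fun k hk => by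
    have h1 := (hT.bounds k hk).1.2
    have h2 := (hT.bounds k hk).2.2
    omega
  have hm'm : m' = m := by
    obtain ⟨L, rfl⟩ := List.getLast?_eq_some_iff.1 hm
    have hp := (hfilter m hmK).2 (by omega)
    rw [List.filter_append, List.filter_cons_of_pos (by simpa using hp), List.filter_nil,
      List.getLast?_concat] at hm'
    exact (Option.some_inj.1 hm').symm
  subst m'
  set D := Finset.Ioc k₁.2 m.2 with hD
  have heval : ∀ c ∈ D, v (T c, c) = s c := fun c hc => by
    rw [hD, Finset.mem_Ioc] at hc
    ext x
    rw [hT.eval _ (hT.mem c hc.1 hc.2)]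
    exact ⟨fun h => h.2.2, fun h => ⟨hc.1, rfl, h⟩⟩
  have hs : ∀ c ∈ D, (s c).card = 1 := fun c hc => by
    rw [hD, Finset.mem_Ioc] at hc
    exact Finset.card_eq_one.2 (hT.singleton c hc.1 hc.2)
  have hdisj : ∀ c ∈ D, ∀ d ∈ D, T c = T d → c ≠ d → Disjoint (s c) (s d) := by
    intro c hc d hd h hcd
    obtain ⟨a, ha⟩ := Finset.card_eq_one.1 (hs c hc)
    obtain ⟨b, hb⟩ := Finset.card_eq_one.1 (hs d hd)
    have hc' := Finset.mem_Ioc.1 hc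
    have hd' := Finset.mem_Ioc.1 hd
    rw [ha, hb, Finset.disjoint_singleton]
    exact hdist _ (hT.mem c hc'.1 hc'.2) _ (hT.mem d hd'.1 hd'.2) (by simp [hcd]) h a b
      ((heval c hc).trans ha) ((heval d hd).trans hb)
  have hTm : ∀ c ∈ D, T c ≤ S.tm := fun c hc => by
    rw [hD, Finset.mem_Ioc] at hc
    exact htm ▸ (hT.bounds _ (hT.mem c hc.1 hc.2)).2.1
  have hT1 : ∀ c ∈ D, S.t1 ≤ T c := fun c hc => by
    rw [hD, Finset.mem_Ioc] at hc
    exact ht1 ▸ (hT.bounds _ (hT.mem c hc.1 hc.2)).1.1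
  have hmono : ∀ c ∈ D, ∀ d ∈ D, c ≤ d → T c ≤ T d := fun c hc d hd hcd => by
    rw [hD, Finset.mem_Ioc] at hc hd
    exact hT.le_time _ (hT.mem d hd.1 hd.2) c hc.1 hcd
  have hvD : ∀ t, S.v t = {c ∈ D | T c = t}.biUnion s := fun t => by
    ext x
    simp only [hv, Finset.mem_biUnion, Finset.mem_filter, hD, Finset.mem_Ioc]
    constructor
    · rintro ⟨k, hk, rfl, hx⟩
      obtain ⟨h1, h2, h3⟩ := (hT.eval k hk x).1 hx
      exact ⟨k.2, ⟨⟨h1, (hT.bounds k hk).2.2⟩, h2.symm⟩, h3⟩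
    · rintro ⟨c, ⟨⟨h1, h2⟩, rfl⟩, hx⟩
      have hk := hT.mem c h1 h2
      exact ⟨_, hk, rfl, (hT.eval _ hk x).2 ⟨h1, rfl, hx⟩⟩
  have hvD'' : ∀ t, S''.v t = {c ∈ {c ∈ D | c₀ ≤ c} | T c = t}.biUnion s := fun t => by
    ext x
    simp only [hv'', List.mem_filter, decide_eq_true_eq, Finset.mem_biUnion, Finset.mem_filter, hD,
      Finset.mem_Ioc]
    constructor
    · rintro ⟨k, ⟨hk, hp⟩, rfl, hx⟩
      obtain ⟨h1, h2, h3⟩ := (hT.eval k hk x).1 hx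
      exact ⟨k.2, ⟨⟨⟨h1, hp.2⟩, (hfilter k hk).1 hp⟩, h2.symm⟩, h3⟩
    · rintro ⟨c, ⟨⟨⟨h1, h2⟩, hc⟩, rfl⟩, hx⟩
      have hk := hT.mem c h1 h2
      exact ⟨_, ⟨hk, (hfilter _ hk).2 hc⟩, rfl, (hT.eval _ hk x).2 ⟨h1, rfl, hx⟩⟩
  have hsum := fun u => sum_card_biUnion_fiber D T s S.v hvD hs hdisj u S.tm hTm
  have htm'' : S''.tm = S.tm := htm'.trans htm.symm
  have hout : ∀ u, u < S''.t1 ∨ S.tm < u → S''.v u = ∅ := fun u hu =>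
    S''.outside u (htm'' ▸ hu)
  rcases le_or_gt c₀ k₁.2 with hc | hc
  · have hle : ∀ u, ∑ w ∈ Finset.Icc u S.tm, (S.v w).card < n := fun u => by
      rw [hsum]
      refine (Finset.card_filter_le _ _).trans_lt ?_
      rw [hD, Nat.card_Ioc]
      omega
    have hEP := S.leftEP_eq S.le le_rfl S.le (.inl rfl) fun w _ _ => hle w
    have hfst : S''.t1 = S.t1 := by
      obtain ⟨L, rfl⟩ := List.head?_eq_some_iff.1 hk₁
      have hp := (hfilter k₁ (by simp)).2 hc
      rw [List.filter_cons_of_pos (by simpa using hp)] at hk₀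
      obtain rfl : k₁ = k₀ := by simpa using hk₀
      rw [ht1', ht1]
    rw [IsTupleWin, hEP, if_pos]
    · refine TStream.ext ?_ htm'' fun t => ?_
      · rw [S.timeWin_sub_t1 S.le le_rfl S.le, hfst]
      · rw [S.timeWin_sub_v S.le le_rfl S.le]
        split_ifs with h
        · rw [hvD, hvD'', Finset.filter_true_of_mem (s := D)]
          intro c hcD
          rw [hD, Finset.mem_Ioc] at hcD
          omega
        · exact hout t (by omega)
    · rw [S.timeWin_sub_size S.le le_rfl S.le]
      exact (hle _).le
  · have hc₀D : c₀ ∈ D := by rw [hD, Finset.mem_Ioc]; omega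
    have hfst : S''.t1 = T c₀ := by
      have hmem : (T c₀, c₀) ∈ K := hT.mem _ hc (by omega)
      have hk₀' := List.mem_of_head? hk₀
      rw [List.mem_filter, decide_eq_true_eq] at hk₀'
      rw [ht1']
      refine le_antisymm ?_ (hT.le_time k₀ hk₀'.1 c₀ hc ((hfilter _ hk₀'.1).1 hk₀'.2))
      have hsorted : K.Pairwise (· ≤ ·) := by
        refine List.isChain_iff_pairwise.1 (hchain.imp ?_)
        rintro k k' (rfl | rfl) <;> simp [Prod.le_def]
      obtain ⟨L, hL⟩ := List.head?_eq_some_iff.1 hk₀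
      have hsorted' := hsorted.filter (fun k => decide (max k₁.2 c₀ ≤ k.2 ∧ k.2 ≤ m.2))
      have hmem' : (T c₀, c₀) ∈ k₀ :: L := by
        rw [← hL, List.mem_filter, decide_eq_true_eq]
        exact ⟨hmem, (hfilter _ hmem).2 le_rfl⟩
      rw [hL, List.pairwise_cons] at hsorted'
      rcases List.mem_cons.1 hmem' with h | h
      · rw [← h]
      · exact (hsorted'.1 _ h).1
    have hcard : ({c ∈ D | c₀ ≤ c} : Finset ℕ).card = n := by
      have : ({c ∈ D | c₀ ≤ c} : Finset ℕ) = Finset.Icc c₀ m.2 := by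
        ext c; simp only [hD, Finset.mem_filter, Finset.mem_Ioc, Finset.mem_Icc]; omega
      rw [this, Nat.card_Icc]; omega
    have hsub : ({c ∈ D | c₀ ≤ c} : Finset ℕ) ⊆ {c ∈ D | T c₀ ≤ T c} := fun c h => by
      rw [Finset.mem_filter] at h ⊢
      exact ⟨h.1, hmono _ hc₀D _ h.1 h.2⟩
    have hEP := S.leftEP_eq (n := n) S.le (hT1 _ hc₀D) (hTm _ hc₀D)
      (.inr (by rw [hsum, ← hcard]; exact Finset.card_le_card hsub)) (by
        intro w hw _
        rw [hsum, ← hcard]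
        refine Finset.card_lt_card ⟨fun c h => ?_, fun h => ?_⟩
        · rw [Finset.mem_filter] at h ⊢
          refine ⟨h.1, ?_⟩
          by_contra hlt
          have := hmono _ h.1 _ hc₀D (by omega)
          omega
        · have := h (Finset.mem_filter.2 ⟨hc₀D, le_rfl⟩)
          rw [Finset.mem_filter] at this
          omega)
    rw [IsTupleWin, hEP, S.timeWin_sub_size S.le (hT1 _ hc₀D) (hTm _ hc₀D), hsum]
    split_ifs with h
    · have heq := Finset.eq_of_subset_of_card_le hsub (h.trans hcard.ge)
      refine TStream.ext ?_ htm'' fun t => ?_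
      · rw [S.timeWin_sub_t1 S.le (hT1 _ hc₀D) (hTm _ hc₀D), hfst]
      · rw [S.timeWin_sub_v S.le (hT1 _ hc₀D) (hTm _ hc₀D)]
        split_ifs with ht
        · rw [hvD, hvD'', heq, Finset.filter_filter]
          congr 1
          ext c
          simp only [Finset.mem_filter]
          refine and_congr_right fun _ => ⟨fun h => h.2, ?_⟩
          rintro rfl
          exact ⟨ht.1, rfl⟩
        · exact hout t (by omega)
    · refine ⟨hfst, htm'', fun u hu _ => ?_, ?_, fun u hu => hout u (hfst ▸ hu), ?_⟩
      · rw [hvD, hvD'', Finset.filter_filter]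
        congr 1
        ext c
        simp only [Finset.mem_filter]
        refine and_congr_right fun hcD => ⟨fun h => h.2, ?_⟩
        rintro rfl
        refine ⟨?_, rfl⟩
        by_contra hlt
        have := hmono _ hcD _ hc₀D (by omega)
        omega
      · rw [hvD, hvD'']
        exact Finset.biUnion_subset_biUnion_of_subset_left _
          (Finset.filter_subset_filter _ (Finset.filter_subset _ _))
      · have hD'' : ∀ c ∈ ({c ∈ D | c₀ ≤ c} : Finset ℕ), c ∈ D :=
          fun c h => (Finset.mem_filter.1 h).1
        rw [TStream.size, hfst, htm'', sum_card_biUnion_fiber _ T s S''.v hvD''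
          (fun c h => hs c (hD'' c h)) (fun c h d h' => hdisj c (hD'' c h) d (hD'' d h'))
          (T c₀) S.tm (fun c h => hTm c (hD'' c h)), Finset.filter_true_of_mem, hcard]
        exact fun c h => (Finset.mem_filter.1 (hsub h)).2

end Ticker
end

section
/- All orderings of a stream have the same tick pattern: if S is a stream and Ṡ1 = (K1, v̇1) and Ṡ2 = (K2, v̇2) are orderings of S that both have pairwise distinct atoms per time point and whose tick patterns have the same initial tick, then K1 = K2. -/
namespace Ticker

variable {A : Type} [DecidableEq A]

theorem TickStep.lt {k k' : Tick} (h : TickStep k k') : k < k' := by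
  rcases h with rfl | rfl
  · exact Prod.mk_lt_mk.2 (Or.inl ⟨by simp, le_rfl⟩)
  · exact Prod.mk_lt_mk.2 (Or.inr ⟨le_rfl, by simp⟩)

theorem pairwise_lt_of_isChain {K : List Tick} (h : K.IsChain TickStep) : K.Pairwise (· < ·) :=
  List.isChain_iff_pairwise.1 (h.imp fun _ _ => TickStep.lt)

/-- A chain of ticks is determined by its first tick and its list of times. -/
theorem eq_of_isChain_of_map_fst_eq {K K' : List Tick} (h : K.IsChain TickStep)
    (h' : K'.IsChain TickStep) (hh : K.head? = K'.head?)
    (ht : K.map Prod.fst = K'.map Prod.fst) : K = K' := by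
  induction K generalizing K' with
  | nil => exact (List.map_eq_nil_iff.1 ht.symm).symm
  | cons a l ih =>
    obtain _ | ⟨a', l'⟩ := K'
    · simp at ht
    obtain rfl : a = a' := by simpa using hh
    congr 1
    obtain _ | ⟨b, l⟩ := l <;> obtain _ | ⟨b', l'⟩ := l'
    · rfl
    · simp at ht
    · simp at ht
    rw [List.isChain_cons_cons] at h h'
    have hb : b.1 = b'.1 := by
      simp only [List.map_cons, List.cons.injEq] at ht
      exact ht.2.1
    refine ih h.2 h'.2 ?_ (List.cons.inj ht).2
    rcases h.1 with rfl | rfl <;> rcases h'.1 with rfl | rfl <;> simp_all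

theorem card_foldr_union {ι B : Type*} [DecidableEq B] (f : ι → Finset B) (l : List ι)
    (h : l.Pairwise fun i j => Disjoint (f i) (f j)) :
    ((l.map f).foldr (· ∪ ·) ∅).card = (l.map fun i => (f i).card).sum := by
  induction l with
  | nil => simp
  | cons a l ih =>
    rw [List.pairwise_cons] at h
    have hd : Disjoint (f a) ((l.map f).foldr (· ∪ ·) ∅) := by
      have := h.1
      clear ih h
      induction l with
      | nil => simp
      | cons b l ih => simp_all
    simp only [List.map_cons, List.foldr_cons, List.sum_cons]
    rw [Finset.card_union_of_disjoint hd, ih h.2]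

/-- Along a chain of ticks, the number of ticks at time `t` exceeds the number of tuples
evaluated at `t` after the first tick by one if `t` lies in the timeline, and by zero otherwise. -/
theorem count_map_fst_cons {B : Type*} (v : Tick → Finset B) (a : Tick) (l : List Tick)
    (hc : (a :: l).IsChain TickStep)
    (hi : (a :: l).IsChain fun k k' =>
      if k' = (k.1, k.2 + 1) then ∃ a, v k' = {a} else v k' = ∅) (t : ℕ) :
    ((a :: l).map Prod.fst).count t =
      ((l.filter fun k => decide (k.1 = t)).map fun k => (v k).card).sum +
        if a.1 ≤ t ∧ t ≤ ((a :: l).getLast (by simp)).1 then 1 else 0 := by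
  induction l generalizing a with
  | nil =>
    simp only [List.map_cons, List.map_nil, List.count_cons, List.count_nil, List.filter_nil,
      List.sum_nil, List.getLast_singleton, beq_iff_eq]
    grind
  | cons b l ih =>
    have hle : b.1 ≤ ((b :: l).getLast (by simp)).1 := by
      rcases List.mem_cons.1 (List.getLast_mem (l := b :: l) (by simp)) with h | h
      · rw [h]
      · have hp := pairwise_lt_of_isChain (List.isChain_cons_cons.1 hc).2
        exact ((List.pairwise_cons.1 hp).1 _ h).le.1
    rw [List.isChain_cons_cons] at hc hi
    have key := ih b hc.2 hi.2
    rw [List.map_cons, List.count_cons, key, List.getLast_cons (List.cons_ne_nil b l),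
      List.filter_cons]
    generalize ((b :: l).getLast (by simp)).1 = m at hle ⊢
    clear key ih
    obtain ⟨hs, -⟩ := hc
    obtain ⟨hv, -⟩ := hi
    rcases hs with rfl | rfl
    · have hv : v (a.1 + 1, a.2) = ∅ := by simpa using hv
      simp only [decide_eq_true_eq, beq_iff_eq, apply_ite (List.map fun k => (v k).card),
        apply_ite List.sum, List.map_cons, List.sum_cons, hv, Finset.card_empty, zero_add, ite_self]
      dsimp only at hle
      split_ifs <;> omega
    · obtain ⟨x, hx⟩ : ∃ x, v (a.1, a.2 + 1) = {x} := by simpa using hv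
      simp only [decide_eq_true_eq, beq_iff_eq, apply_ite (List.map fun k => (v k).card),
        apply_ite List.sum, List.map_cons, List.sum_cons, hx, Finset.card_singleton]
      dsimp only at hle
      split_ifs <;> omega

theorem TickStream.vdot_eq_empty_or_singleton (P : TickStream A) {k : Tick} (hk : k ∈ P.K) :
    P.vdot k = ∅ ∨ ∃ a, P.vdot k = {a} := by
  have aux : ∀ l : List Tick, (∀ k ∈ l.head?, P.vdot k = ∅ ∨ ∃ a, P.vdot k = {a}) →
      (l.IsChain fun k k' =>
        if k' = (k.1, k.2 + 1) then ∃ a, P.vdot k' = {a} else P.vdot k' = ∅) →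
      ∀ k ∈ l, P.vdot k = ∅ ∨ ∃ a, P.vdot k = {a} := by
    intro l
    induction l with
    | nil => simp
    | cons a l ih =>
      intro h0 hc k hk
      rcases List.mem_cons.1 hk with rfl | hk
      · exact h0 _ (by simp)
      · rw [List.isChain_cons] at hc
        refine ih (fun k hk => ?_) hc.2 k hk
        have := hc.1 k hk
        split_ifs at this <;> simp [this]
  exact aux P.K (fun k hk => Or.inl (P.init k hk)) P.incr k hk

theorem TickStream.card_atTime (P : TickStream A) (hd : DistinctPerTime P.toPreTick) (t : ℕ) :
    (P.atTime t).card =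
      ((P.K.filter fun k => decide (k.1 = t)).map fun k => (P.vdot k).card).sum := by
  refine card_foldr_union _ _ ?_
  have hp := (pairwise_lt_of_isChain P.chain).filter fun k => decide (k.1 = t)
  refine hp.imp_of_mem fun {k k'} hk hk' hlt => ?_
  simp only [List.mem_filter, decide_eq_true_eq] at hk hk'
  rcases P.vdot_eq_empty_or_singleton hk.1 with h | ⟨a, ha⟩
  · simp [h]
  rcases P.vdot_eq_empty_or_singleton hk'.1 with h | ⟨a', ha'⟩
  · simp [h]
  rw [ha, ha', Finset.disjoint_singleton]
  exact hd k hk.1 k' hk'.1 hlt.ne (hk.2.trans hk'.2.symm) a a' ha ha'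

/-- In an ordering with pairwise distinct atoms per time point, every time point `t` of the
timeline carries exactly `|v(t)| + 1` ticks. -/
theorem TickStream.count_map_fst (P : TickStream A) {S : TStream A}
    (hU : Underlies S P.toPreTick) (hd : DistinctPerTime P.toPreTick) (t : ℕ) :
    (P.K.map Prod.fst).count t =
      (S.v t).card + if S.t1 ≤ t ∧ t ≤ S.tm then 1 else 0 := by
  obtain ⟨⟨k, hk, h1⟩, ⟨k', hk', hm⟩, hv⟩ := hU
  rw [hv, P.card_atTime hd, h1, hm]
  have hc := P.chain
  have hi := P.incr
  have h0 := P.init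
  generalize P.K = K at *
  obtain _ | ⟨a, l⟩ := K
  · simp at hk
  obtain rfl : a = k := by simpa using hk
  rw [List.getLast?_eq_some_getLast (by simp), Option.mem_some_iff] at hk'
  rw [count_map_fst_cons P.vdot a l hc hi t, hk', List.filter_cons]
  have ha : P.vdot a = ∅ := h0 a (by simp)
  split_ifs <;> simp [ha]

/-- All orderings of a stream have the same tick pattern: if `Ṡ1`
and `Ṡ2` are orderings of the stream `S`, both with pairwise distinct atoms per time
point and with the same initial tick, then their tick patterns coincide. -/
theorem orderings_same_tickPattern {A : Type} [Countable A] [DecidableEq A]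
    (S : TStream A) (P1 P2 : TickStream A)
    (hU1 : Underlies S P1.toPreTick) (hU2 : Underlies S P2.toPreTick)
    (hd1 : DistinctPerTime P1.toPreTick) (hd2 : DistinctPerTime P2.toPreTick)
    (hh : P1.K.head? = P2.K.head?) :
    P1.K = P2.K := by
  refine eq_of_isChain_of_map_fst_eq P1.chain P2.chain hh ?_
  have hsort : ∀ P : TickStream A, (P.K.map Prod.fst).Pairwise (· ≤ ·) := fun P =>
    List.pairwise_map.2 ((pairwise_lt_of_isChain P.chain).imp fun h => h.le.1)
  refine List.Perm.eq_of_pairwise' (hsort P1) (hsort P2) ?_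
  rw [List.perm_iff_count]
  exact fun t => (P1.count_map_fst hU1 hd1 t).trans (P2.count_map_fst hU2 hd2 t).symm

end Ticker
end

section
/- Tuple windows over intensional atoms destroy existence of answer streams: let a be an extensional atom and b an intensional atom, let D = ([0, 1], v_D) be the data stream with v_D(0) = {a} and v_D(1) = ∅, and let P consist of the single rule b ← ⊞^{#_1} ◇ a, where the tuple-window atom is evaluated over the interpretation stream itself. Then no interpretation stream I for D is an answer stream of P for D at time 1; that is, P has no answer stream for D at 1 (for every choice of sliding tuple-based windows satisfying the defining conditions, which in this instance determine the window uniquely). -/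
namespace Ticker

variable {A : Type} [DecidableEq A]

/-- The body `⊞^{#_1} ◇ a` of the rule holds in the interpretation stream `I` at
time `1`: `a` occurs in a sliding tuple-based window of `I` of size 1 at 1 at some
time point of that window's timeline. -/
def BodyHolds10 (a : A) (I : TStream A) : Prop :=
  ∃ h : I.t1 ≤ 1, ∃ S' : TStream A, IsTupleWin I 1 1 h S' ∧
    ∃ u, S'.t1 ≤ u ∧ u ≤ S'.tm ∧ a ∈ S'.v u

/-- `I` is an interpretation stream for the data stream `D` (w.r.t. the
extensionality predicate `ext`): same timeline, and the extensional part of the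
evaluation coincides with that of `D` everywhere. -/
def IsInterp10 (ext : A → Bool) (D I : TStream A) : Prop :=
  I.t1 = D.t1 ∧ I.tm = D.tm ∧ ∀ u, (I.v u).filter (fun x => ext x) = D.v u

theorem TStream.size_timeWin_sub (S : TStream A) {u t : ℕ} (ht : S.t1 ≤ t) (hu : S.t1 ≤ u)
    (hut : u ≤ t) :
    (S.timeWin (t - u) t ht).size = ∑ w ∈ Finset.Icc u t, (S.v w).card := by
  have h : max S.t1 (t - (t - u)) = u := by omega
  simp only [TStream.size, TStream.timeWin, h]
  refine Finset.sum_congr rfl fun w hw => ?_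
  rw [if_pos (Finset.mem_Icc.mp hw)]

theorem TStream.le_leftEP (S : TStream A) {n u t : ℕ} (ht : S.t1 ≤ t) (hu : S.t1 ≤ u)
    (hut : u ≤ t) (hn : n ≤ ∑ w ∈ Finset.Icc u t, (S.v w).card) : u ≤ S.leftEP n t ht := by
  refine Finset.le_max' _ _ (Finset.mem_insert_of_mem ?_)
  simpa [hu, hut, S.size_timeWin_sub ht hu hut] using hn

theorem TStream.leftEP_le (S : TStream A) (n : ℕ) {t : ℕ} (ht : S.t1 ≤ t) :
    S.leftEP n t ht ≤ t := by
  refine Finset.max'_le _ _ _ fun u hu => ?_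
  rcases Finset.mem_insert.mp hu with rfl | hu
  · exact ht
  · exact (Finset.mem_Icc.mp (Finset.mem_filter.mp hu).1).2

theorem TStream.t1_le_leftEP (S : TStream A) (n : ℕ) {t : ℕ} (ht : S.t1 ≤ t) :
    S.t1 ≤ S.leftEP n t ht :=
  Finset.le_max' _ _ (Finset.mem_insert_self _ _)

theorem TStream.le_sum_leftEP (S : TStream A) {n t : ℕ} (ht : S.t1 ≤ t)
    (h : S.leftEP n t ht ≠ S.t1) :
    n ≤ ∑ w ∈ Finset.Icc (S.leftEP n t ht) t, (S.v w).card := by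
  have hm : S.leftEP n t ht ∈ _ := Finset.max'_mem _ (Finset.insert_nonempty _ _)
  have hs := (Finset.mem_filter.mp ((Finset.mem_insert.mp hm).resolve_left h)).2
  rwa [S.size_timeWin_sub ht (S.t1_le_leftEP n ht) (S.leftEP_le n ht)] at hs

/-- If the evaluation at `t` already has at least `n` atoms, then a tuple-based window of
size `n` at `t` contains only atoms evaluated at `t`. -/
theorem IsTupleWin.mem_of_le_card {S S' : TStream A} {n t : ℕ} {ht : S.t1 ≤ t}
    (h : IsTupleWin S n t ht S') (hn : n ≤ (S.v t).card) {x : A} {u : ℕ}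
    (hu : S'.t1 ≤ u) (hut : u ≤ S'.tm) (hx : x ∈ S'.v u) : x ∈ S.v t := by
  have hl : S.leftEP n t ht = t :=
    le_antisymm (S.leftEP_le n ht) (S.le_leftEP ht ht le_rfl (by simpa using hn))
  unfold IsTupleWin at h
  split_ifs at h
  · subst h
    simp only [hl, TStream.timeWin] at hu hut hx
    obtain rfl : u = t := by omega
    simpa [ht] using hx
  · rw [hl] at h
    obtain ⟨h1, hm, -, hsub, -, -⟩ := h
    obtain rfl : u = t := by omega
    exact hsub hx

theorem bodyHolds10_of_eq {a : A} {I : TStream A} (h1 : I.t1 = 0) (hv0 : I.v 0 = {a})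
    (hv1 : I.v 1 = ∅) : BodyHolds10 a I := by
  have ht : I.t1 ≤ 1 := by omega
  have hl : I.leftEP 1 1 ht = 0 := by
    by_contra hne
    have hs := I.le_sum_leftEP ht (by rwa [h1])
    have hl1 : I.leftEP 1 1 ht = 1 := by have := I.leftEP_le 1 ht; omega
    simp [hl1, hv1] at hs
  refine ⟨ht, I.timeWin 1 1 ht, ?_, 0, by simp [TStream.timeWin, h1], by simp [TStream.timeWin],
    by simp [TStream.timeWin, h1, hv0]⟩
  have hsize : (I.timeWin (1 - 0) 1 ht).size ≤ 1 := by
    rw [I.size_timeWin_sub ht (by omega) (by omega),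
      Finset.sum_Icc_succ_top (by omega : 0 ≤ 0 + 1)]
    simp [hv0, hv1]
  rw [IsTupleWin, hl, if_pos hsize]

theorem isInterp10_self_of_isInterp10 {ext : A → Bool} {D I : TStream A}
    (h : IsInterp10 ext D I) : IsInterp10 ext D D :=
  ⟨rfl, rfl, fun u => by simp [← h.2.2 u, Finset.filter_filter]⟩

/-- Tuple windows over intensional atoms destroy existence of
answer streams: for the data stream `D = ([0,1], {0 ↦ {a}})` with `a` extensional and
`b` intensional, the program `{ b ← ⊞^{#_1} ◇ a }` (the tuple window evaluated over
the interpretation stream itself) has no answer stream for `D` at time `1`. -/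
theorem no_answer_stream_tuple_window_intensional
    {A : Type} [Countable A] [DecidableEq A] (ext : A → Bool) (a b : A)
    (ha : ext a = true) (hb : ext b = false)
    (D : TStream A) (hD1 : D.t1 = 0) (hDm : D.tm = 1)
    (hD0 : D.v 0 = {a}) (hDo : ∀ u, u ≠ 0 → D.v u = ∅) :
    ¬ ∃ I : TStream A, IsInterp10 ext D I ∧
        (BodyHolds10 a I → b ∈ I.v 1) ∧
        ¬ ∃ I' : TStream A, IsInterp10 ext D I' ∧ (∀ u, I'.v u ⊆ I.v u) ∧ I'.v ≠ I.v ∧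
            (BodyHolds10 a I → BodyHolds10 a I' → b ∈ I'.v 1) := by
  rintro ⟨I, hI, hrule, hmin⟩
  have hsub : ∀ u, D.v u ⊆ I.v u := fun u => hI.2.2 u ▸ Finset.filter_subset _ _
  have hbody : ¬ BodyHolds10 a I := by
    intro hB
    have hbI := hrule hB
    obtain ⟨ht, S', hW, u, hu, hut, hau⟩ := hB
    have haI : a ∈ I.v 1 :=
      hW.mem_of_le_card (Finset.card_pos.mpr ⟨b, hbI⟩) hu hut hau
    have haD : a ∈ D.v 1 := by
      rw [← hI.2.2 1]
      exact Finset.mem_filter.mpr ⟨haI, ha⟩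
    simp [hDo 1 one_ne_zero] at haD
  have hv : D.v = I.v := by
    by_contra hne
    exact hmin ⟨D, isInterp10_self_of_isInterp10 hI, hsub, hne, fun hB => absurd hB hbody⟩
  exact hbody (bodyHolds10_of_eq (hI.1.trans hD1) (hv ▸ hD0) (hv ▸ hDo 1 one_ne_zero))

end Ticker
end
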